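/- Let H be a complex Hilbert space and k ∈ ℕ. Let φ₋ be a normal state on B(H^{∧k}), viewed also as a normal state on B(H^{⊗k}) via the identification B(H^{∧k}) ≅ P₋B(H^{⊗k})P₋. Then q_{K^{∧k}}(φ₋) = (1/k!)·q_{K^{⊗k}}(φ₋). In particular q_{K^{⊗k}}(φ₋) ≥ k!, and q_{K^{⊗k}}(φ₋) = k! if and only if φ₋ is fermionic separable, i.e. φ₋ lies in the norm-closed convex hull of {ω_ξ : ξ ∈ V^{∧k}}. -/

import Mathlib

noncomputable section

open scoped InnerProductSpace ENNReal Pointwise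

/-- The vector functional `ω_{ξ,η}` on `B(H)` given by `x ↦ ⟨xξ, η⟩`
(linear in `x`; in Mathlib's convention this is `⟪η, x ξ⟫_ℂ`). -/
def omegaFunctional {H : Type*} [NormedAddCommGroup H] [InnerProductSpace ℂ H]
    (ξ η : H) : (H →L[ℂ] H) →L[ℂ] ℂ :=
  (innerSL ℂ η).comp (ContinuousLinearMap.apply ℂ H ξ)

/-- A continuous linear functional on `B(H)` is *normal* if it lies in the norm closure of the
linear span of the vector functionals (this is the predual `B(H)_*`, i.e. the trace-class
induced functionals). -/
def IsNormalFunctional {H : Type*} [NormedAddCommGroup H] [InnerProductSpace ℂ H]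
    (ψ : (H →L[ℂ] H) →L[ℂ] ℂ) : Prop :=
  ψ ∈ closure (Submodule.span ℂ {φ : (H →L[ℂ] H) →L[ℂ] ℂ | ∃ ξ η : H, φ = omegaFunctional ξ η} :
    Set ((H →L[ℂ] H) →L[ℂ] ℂ))

/-- A *normal state* on `B(H)`: a positive normal functional of norm one. -/
def IsNormalState {H : Type*} [NormedAddCommGroup H] [InnerProductSpace ℂ H] [CompleteSpace H]
    (φ : (H →L[ℂ] H) →L[ℂ] ℂ) : Prop :=
  IsNormalFunctional φ ∧ ‖φ‖ = 1 ∧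
    ∀ x : H →L[ℂ] H, x.IsPositive → 0 ≤ (φ x).re ∧ (φ x).im = 0

/-- `‖x‖_K := sup {|ψ(x)| : ψ ∈ K}`. -/
def normK {H : Type*} [NormedAddCommGroup H] [InnerProductSpace ℂ H]
    (K : Set ((H →L[ℂ] H) →L[ℂ] ℂ)) (x : H →L[ℂ] H) : ℝ :=
  sSup ((fun ψ : (H →L[ℂ] H) →L[ℂ] ℂ => ‖ψ x‖) '' K)

/-- The Minkowski functional `q_K(ψ) := inf {α ≥ 0 : ψ ∈ αK}`, with value `∞` if no
such `α` exists. -/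
def qK {H : Type*} [NormedAddCommGroup H] [InnerProductSpace ℂ H]
    (K : Set ((H →L[ℂ] H) →L[ℂ] ℂ)) (ψ : (H →L[ℂ] H) →L[ℂ] ℂ) : ℝ≥0∞ :=
  sInf {c : ℝ≥0∞ | ∃ r : ℝ, 0 ≤ r ∧ c = ENNReal.ofReal r ∧ ψ ∈ r • K}


/-- An abstract presentation of the `k`-fold Hilbert space tensor power `H^{⊗k}` of `H`,
realized on a Hilbert space `T`: a continuous multilinear map `tprod` (the elementary tensors
`η₁ ⊗ ... ⊗ η_k`) whose inner products multiply, whose range has dense linear span, together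
with the permutation unitaries `U_π` permuting the tensor factors. -/
structure HilbertTensorPower (k : ℕ) (H T : Type*) [NormedAddCommGroup H]
    [InnerProductSpace ℂ H] [NormedAddCommGroup T] [InnerProductSpace ℂ T] where
  tprod : ContinuousMultilinearMap ℂ (fun _ : Fin k => H) T
  inner_tprod : ∀ ξ η : Fin k → H, ⟪tprod ξ, tprod η⟫_ℂ = ∏ i, ⟪ξ i, η i⟫_ℂ
  span_dense : (Submodule.span ℂ (Set.range ⇑tprod)).topologicalClosure = ⊤
  U : Equiv.Perm (Fin k) → (T →L[ℂ] T)
  U_isometry : ∀ π, Isometry ⇑(U π)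
  U_surjective : ∀ π, Function.Surjective ⇑(U π)
  U_tprod : ∀ (π : Equiv.Perm (Fin k)) (ξ : Fin k → H),
    U π (tprod ξ) = tprod fun i => ξ (π i)

namespace HilbertTensorPower

variable {k : ℕ} {H T : Type*} [NormedAddCommGroup H] [InnerProductSpace ℂ H]
  [NormedAddCommGroup T] [InnerProductSpace ℂ T]

/-- The symmetrization projection `P₊ = (1/k!) Σ_π U_π`. -/
def Pplus (P : HilbertTensorPower k H T) : T →L[ℂ] T :=
  ((k.factorial : ℂ))⁻¹ • ∑ π : Equiv.Perm (Fin k), P.U π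

/-- The antisymmetrization projection `P₋ = (1/k!) Σ_π sign(π) U_π`. -/
def Pminus (P : HilbertTensorPower k H T) : T →L[ℂ] T :=
  ((k.factorial : ℂ))⁻¹ •
    ∑ π : Equiv.Perm (Fin k), (((Equiv.Perm.sign π : ℤ) : ℂ)) • P.U π

/-- The wedge product `η₁ ∧ ... ∧ η_k := √(k!) · P₋(η₁ ⊗ ... ⊗ η_k)`. -/
def wedge (P : HilbertTensorPower k H T) (η : Fin k → H) : T :=
  (Real.sqrt k.factorial : ℂ) • P.Pminus (P.tprod η)

/-- The set `V^{⊗k}` of unit product vectors. -/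
def prodVecs (P : HilbertTensorPower k H T) : Set T :=
  {ζ : T | ∃ η : Fin k → H, (∀ i, ‖η i‖ = 1) ∧ ζ = P.tprod η}

/-- The set `V^{∨k}` of symmetric unit product vectors `η ⊗ ... ⊗ η`. -/
def symVecs (P : HilbertTensorPower k H T) : Set T :=
  {ζ : T | ∃ η : H, ‖η‖ = 1 ∧ ζ = P.tprod fun _ => η}

/-- The set `V^{∧k}` of unit wedge (Slater) vectors. -/
def wedgeVecs (P : HilbertTensorPower k H T) : Set T :=
  {ζ : T | ∃ η : Fin k → H, ζ = P.wedge η ∧ ‖ζ‖ = 1}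

end HilbertTensorPower


namespace HilbertTensorPower

open Finset

section Wedge

variable {k : ℕ} {H T : Type*} [NormedAddCommGroup H] [InnerProductSpace ℂ H]
  [NormedAddCommGroup T] [InnerProductSpace ℂ T] (P : HilbertTensorPower k H T)

/-- The wedge product as an alternating map. -/
def wedgeAlternating : H [⋀^Fin k]→ₗ[ℂ] T :=
  ((Real.sqrt k.factorial : ℂ) * (k.factorial : ℂ)⁻¹) •
    MultilinearMap.alternatization P.tprod.toMultilinearMap

theorem Pminus_apply (x : T) : P.Pminus x =
    (k.factorial : ℂ)⁻¹ • ∑ π : Equiv.Perm (Fin k), ((Equiv.Perm.sign π : ℤ) : ℂ) • P.U π x := by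
  simp [Pminus]

theorem wedge_eq_sum (η : Fin k → H) : P.wedge η =
    ((Real.sqrt k.factorial : ℂ) * (k.factorial : ℂ)⁻¹) •
      ∑ π : Equiv.Perm (Fin k), ((Equiv.Perm.sign π : ℤ) : ℂ) • P.tprod fun i => η (π i) := by
  simp only [wedge, Pminus_apply, U_tprod, smul_smul]

theorem wedgeAlternating_apply (η : Fin k → H) : P.wedgeAlternating η = P.wedge η := by
  rw [wedge_eq_sum, wedgeAlternating, AlternatingMap.smul_apply,
    MultilinearMap.alternatization_apply]
  congr 1
  refine sum_congr rfl fun π _ => ?_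
  rw [Units.smul_def, ← Int.cast_smul_eq_zsmul ℂ]
  rfl

theorem sqrt_factorial_mul_self (k : ℕ) :
    (Real.sqrt k.factorial : ℂ) * (Real.sqrt k.factorial : ℂ) = k.factorial := by
  rw [← Complex.ofReal_mul, Real.mul_self_sqrt (Nat.cast_nonneg _), Complex.ofReal_natCast]

theorem Pminus_tprod (η : Fin k → H) :
    P.Pminus (P.tprod η) = ((Real.sqrt k.factorial : ℝ) : ℂ)⁻¹ • P.wedge η := by
  have : (Real.sqrt k.factorial : ℂ) ≠ 0 := by
    exact_mod_cast (Real.sqrt_pos.2 (Nat.cast_pos.2 k.factorial_pos)).ne'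
  rw [wedge, smul_smul, inv_mul_cancel₀ this, one_smul]

theorem norm_tprod (η : Fin k → H) : ‖P.tprod η‖ = ∏ i, ‖η i‖ := by
  have h := P.inner_tprod η η
  simp only [inner_self_eq_norm_sq_to_K] at h
  rw [prod_pow] at h
  have h' : ‖P.tprod η‖ ^ 2 = (∏ i, ‖η i‖) ^ 2 := by exact_mod_cast h
  exact (pow_left_inj₀ (norm_nonneg _) (prod_nonneg fun _ _ => norm_nonneg _) two_ne_zero).1 h'

theorem norm_wedge_of_orthonormal {e : Fin k → H} (he : Orthonormal ℂ e) : ‖P.wedge e‖ = 1 := by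
  have hon : Orthonormal ℂ fun π : Equiv.Perm (Fin k) => P.tprod fun i => e (π i) := by
    classical
    rw [orthonormal_iff_ite] at he ⊢
    intro π σ
    rw [inner_tprod]
    simp only [he]
    split_ifs with h
    · simp [h]
    · obtain ⟨i, hi⟩ : ∃ i, π i ≠ σ i := by
        by_contra! hc
        exact h (Equiv.ext hc)
      exact prod_eq_zero (mem_univ i) (by simp [hi])
  have hsq : ‖P.wedge e‖ ^ 2 = 1 := by
    have hf : (k.factorial : ℝ) ≠ 0 := Nat.cast_ne_zero.2 k.factorial_ne_zero
    have hs : ‖∑ π : Equiv.Perm (Fin k), ((Equiv.Perm.sign π : ℤ) : ℂ) •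
        P.tprod fun i => e (π i)‖ ^ 2 = k.factorial := by
      have hin := hon.inner_sum (fun π => ((Equiv.Perm.sign π : ℤ) : ℂ))
        (fun π => ((Equiv.Perm.sign π : ℤ) : ℂ)) univ
      have h1 : ∀ π : Equiv.Perm (Fin k), (starRingEnd ℂ) ((Equiv.Perm.sign π : ℤ) : ℂ) *
          ((Equiv.Perm.sign π : ℤ) : ℂ) = 1 := by
        intro π
        rcases Int.units_eq_one_or (Equiv.Perm.sign π) with h | h <;> simp [h]
      rw [inner_self_eq_norm_sq_to_K, sum_congr rfl fun π _ => h1 π] at hin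
      simp only [sum_const, card_univ, Fintype.card_perm, Fintype.card_fin, nsmul_eq_mul,
        mul_one] at hin
      refine Complex.ofReal_injective ?_
      push_cast
      exact hin
    rw [wedge_eq_sum, norm_smul, mul_pow, hs, norm_mul, mul_pow, norm_inv, Complex.norm_real,
      Complex.norm_natCast, Real.norm_of_nonneg (Real.sqrt_nonneg _),
      Real.sq_sqrt (Nat.cast_nonneg _)]
    field_simp
  exact (pow_eq_one_iff_of_nonneg (norm_nonneg _) two_ne_zero).1 hsq

/-- A nonzero wedge is a scalar multiple of the wedge of an orthonormal family, and the scalar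
obeys Hadamard's inequality. -/
theorem exists_orthonormal_wedge {η : Fin k → H} (h : P.wedge η ≠ 0) :
    ∃ (e : Fin k → H) (c : ℂ), Orthonormal ℂ e ∧ P.wedge η = c • P.wedge e ∧
      ‖c‖ ≤ ∏ i, ‖η i‖ := by
  classical
  have hli : LinearIndependent ℂ η := by
    by_contra hc
    exact h (by rw [← wedgeAlternating_apply]; exact P.wedgeAlternating.map_linearDependent η hc)
  let S := Submodule.span ℂ (Set.range η)
  let f : Fin k → S := fun i => ⟨η i, Submodule.subset_span ⟨i, rfl⟩⟩
  have : FiniteDimensional ℂ S := FiniteDimensional.span_of_finite ℂ (Set.finite_range η)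
  have hdim : Module.finrank ℂ S = Fintype.card (Fin k) := finrank_span_eq_card hli
  let b := InnerProductSpace.gramSchmidtOrthonormalBasis hdim f
  have hb : Orthonormal ℂ fun i => (b i : H) := b.orthonormal.comp_linearIsometry S.subtypeₗᵢ
  refine ⟨fun i => b i, b.toBasis.det f, hb, ?_, ?_⟩
  · let A := P.wedgeAlternating.compLinearMap S.subtype
    have hA : A = b.toBasis.det.smulRight (A b) := by
      refine Module.Basis.ext_alternating b.toBasis fun i hi => ?_
      let σ : Equiv.Perm (Fin k) := Equiv.ofBijective i (Finite.injective_iff_bijective.1 hi)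
      change A (b.toBasis ∘ σ) = b.toBasis.det (b.toBasis ∘ σ) • A b
      rw [AlternatingMap.map_perm, AlternatingMap.map_perm, b.toBasis.det_self, Units.smul_def,
        Units.smul_def, ← Int.cast_smul_eq_zsmul ℂ, OrthonormalBasis.coe_toBasis]
      simp
    have := congrArg (fun g => g f) hA
    change P.wedgeAlternating η = b.toBasis.det f • P.wedgeAlternating (fun i => (b i : H)) at this
    simpa only [wedgeAlternating_apply] using this
  · rw [InnerProductSpace.gramSchmidtOrthonormalBasis_det, norm_prod]
    refine prod_le_prod (fun _ _ => norm_nonneg _) fun i _ => ?_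
    refine (norm_inner_le_norm _ _).trans ?_
    rw [b.orthonormal.1 i, one_mul]
    rfl

theorem norm_wedge_le (η : Fin k → H) : ‖P.wedge η‖ ≤ ∏ i, ‖η i‖ := by
  by_cases h : P.wedge η = 0
  · rw [h, norm_zero]
    exact prod_nonneg fun _ _ => norm_nonneg _
  · obtain ⟨e, c, he, hc, hle⟩ := P.exists_orthonormal_wedge h
    rwa [hc, norm_smul, P.norm_wedge_of_orthonormal he, mul_one]

theorem exists_smul_wedge [NeZero k] (c : ℂ) (η : Fin k → H) :
    c • P.wedge η = P.wedge (Function.update η 0 (c • η 0)) := by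
  rw [← wedgeAlternating_apply, ← wedgeAlternating_apply, AlternatingMap.map_update_smul,
    Function.update_eq_self]

theorem wedge_of_isEmpty [IsEmpty (Fin k)] (η : Fin k → H) : P.wedge η = P.tprod η := by
  have : k = 0 := by
    rcases k with _ | k
    · rfl
    · exact isEmptyElim (0 : Fin (k + 1))
  subst this
  simp [wedge_eq_sum, Subsingleton.elim (fun i => η _) η]

/-- A unit wedge is the wedge of a family of unit vectors. -/
theorem exists_unit_of_mem_wedgeVecs {ζ : T} (hζ : ζ ∈ P.wedgeVecs) :
    ∃ e : Fin k → H, (∀ i, ‖e i‖ = 1) ∧ ζ = P.wedge e := by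
  obtain ⟨η, rfl, h1⟩ := hζ
  obtain ⟨e, c, he, hc, -⟩ := P.exists_orthonormal_wedge (η := η) (by
    intro h; simp [h] at h1)
  rcases isEmpty_or_nonempty (Fin k) with hk | hk
  · exact ⟨η, fun i => hk.elim i, rfl⟩
  · have : NeZero k := ⟨fun h => by subst h; exact Fin.elim0 hk.some⟩
    have hc1 : ‖c‖ = 1 := by
      rwa [hc, norm_smul, P.norm_wedge_of_orthonormal he, mul_one] at h1
    refine ⟨_, fun i => ?_, hc.trans (P.exists_smul_wedge c e)⟩
    rcases eq_or_ne i 0 with rfl | hi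
    · simp [norm_smul, hc1, he.1 0]
    · simp [Function.update_of_ne hi, he.1 i]

theorem sign_smul_tprod_mem_prodVecs {e : Fin k → H} (he : ∀ i, ‖e i‖ = 1)
    (π : Equiv.Perm (Fin k)) :
    (((Equiv.Perm.sign π : ℤ) : ℂ) • P.tprod fun i => e (π i)) ∈ P.prodVecs := by
  rcases Int.units_eq_one_or (Equiv.Perm.sign π) with h | h
  · exact ⟨fun i => e (π i), fun i => he _, by simp [h]⟩
  · have hk : NeZero k := ⟨by
      rintro rfl
      simp [Subsingleton.elim π 1] at h⟩
    refine ⟨Function.update (fun i => e (π i)) 0 ((-1 : ℂ) • e (π 0)), fun i => ?_, ?_⟩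
    · rcases eq_or_ne i 0 with rfl | hi
      · simp [he]
      · simp [Function.update_of_ne hi, he]
    · rw [P.tprod.map_update_smul, Function.update_eq_self]
      simp [h]

theorem inner_Pminus_left (x y : T) : ⟪P.Pminus x, y⟫_ℂ = ⟪x, P.Pminus y⟫_ℂ := by
  have hd : Dense (Submodule.span ℂ (Set.range ⇑P.tprod) : Set T) :=
    (Submodule.dense_iff_topologicalClosure_eq_top).2 P.span_dense
  have htt : ∀ ξ η, ⟪P.Pminus (P.tprod ξ), P.tprod η⟫_ℂ = ⟪P.tprod ξ, P.Pminus (P.tprod η)⟫_ℂ := by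
    intro ξ η
    simp only [Pminus_apply, inner_smul_left, inner_smul_right, sum_inner, inner_sum, U_tprod,
      inner_tprod, map_inv₀, Complex.conj_natCast, map_intCast]
    congr 1
    refine Fintype.sum_equiv (Equiv.inv _) _ _ fun π => ?_
    rw [Equiv.inv_apply, Equiv.Perm.sign_inv]
    congr 1
    exact Fintype.prod_equiv π _ _ fun i => by simp
  have ht : ∀ ξ y, ⟪P.Pminus (P.tprod ξ), y⟫_ℂ = ⟪P.tprod ξ, P.Pminus y⟫_ℂ := by
    intro ξ y
    have : innerSL ℂ (P.Pminus (P.tprod ξ)) = innerSL ℂ (P.tprod ξ) ∘L P.Pminus := by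
      refine ContinuousLinearMap.ext_on hd ?_
      rintro _ ⟨η, rfl⟩
      exact htt ξ η
    exact congrArg (fun g : T →L[ℂ] ℂ => g y) this
  have : innerSL ℂ (P.Pminus y) = innerSL ℂ y ∘L P.Pminus := by
    refine ContinuousLinearMap.ext_on hd ?_
    rintro _ ⟨ξ, rfl⟩
    have := congrArg (starRingEnd ℂ) (ht ξ y)
    simp only [inner_conj_symm] at this
    exact this.symm
  have := congrArg (fun g : T →L[ℂ] ℂ => starRingEnd ℂ (g x)) this
  simpa using this.symm

end Wedge
end HilbertTensorPower

section NormedDual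

set_option maxSynthPendingDepth 3

section Functionals

variable {H : Type*} [NormedAddCommGroup H] [InnerProductSpace ℂ H]

theorem omegaFunctional_apply (ξ η : H) (x : H →L[ℂ] H) :
    omegaFunctional ξ η x = ⟪η, x ξ⟫_ℂ := rfl

theorem omegaFunctional_smul_left (c : ℂ) (ξ η : H) :
    omegaFunctional (c • ξ) η = c • omegaFunctional ξ η := by
  ext x
  simp [omegaFunctional_apply]

theorem omegaFunctional_smul_right (c : ℂ) (ξ η : H) :
    omegaFunctional ξ (c • η) = starRingEnd ℂ c • omegaFunctional ξ η := by
  ext x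
  exact inner_smul_left _ _ _

theorem omegaFunctional_sum {ι κ : Type*} (s : Finset ι) (t : Finset κ) (ξ : ι → H) (η : κ → H) :
    omegaFunctional (∑ i ∈ s, ξ i) (∑ j ∈ t, η j) =
      ∑ i ∈ s, ∑ j ∈ t, omegaFunctional (ξ i) (η j) := by
  ext x
  simp only [omegaFunctional_apply, map_sum, sum_inner, inner_sum, sum_apply]

theorem norm_omegaFunctional_le (ξ η : H) : ‖omegaFunctional ξ η‖ ≤ ‖ξ‖ * ‖η‖ := by
  refine ContinuousLinearMap.opNorm_le_bound _ (by positivity) fun x => ?_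
  rw [omegaFunctional_apply]
  calc ‖⟪η, x ξ⟫_ℂ‖ ≤ ‖η‖ * ‖x ξ‖ := norm_inner_le_norm _ _
    _ ≤ ‖η‖ * (‖x‖ * ‖ξ‖) := by gcongr; exact x.le_opNorm ξ
    _ = ‖ξ‖ * ‖η‖ * ‖x‖ := by ring

theorem omegaFunctional_sub_right (ξ η η' : H) :
    omegaFunctional ξ (η - η') = omegaFunctional ξ η - omegaFunctional ξ η' := by
  ext x
  simp [omegaFunctional_apply]

/-- A positive functional of norm one on `B(H)` takes a value of real part at least one at the
identity. -/
theorem one_le_re_apply_one [CompleteSpace H] {φ : (H →L[ℂ] H) →L[ℂ] ℂ} (h1 : ‖φ‖ = 1)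
    (hpos : ∀ x : H →L[ℂ] H, x.IsPositive → 0 ≤ (φ x).re ∧ (φ x).im = 0) :
    1 ≤ (φ 1).re := by
  have hone := hpos 1 ContinuousLinearMap.isPositive_one
  have hsa : ∀ a : H →L[ℂ] H, IsSelfAdjoint a →
      (φ a).im = 0 ∧ (φ a).re ≤ ‖a‖ * (φ 1).re := by
    intro a ha
    have hle : a ≤ algebraMap ℝ (H →L[ℂ] H) ‖a‖ := ha.le_algebraMap_norm_self
    rw [ContinuousLinearMap.le_def, Algebra.algebraMap_eq_smul_one] at hle
    have hp := hpos _ hle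
    have hs : φ (‖a‖ • (1 : H →L[ℂ] H)) = (‖a‖ : ℂ) * φ 1 := by
      rw [← Complex.coe_smul, map_smul, smul_eq_mul]
    rw [map_sub, hs, Complex.sub_re, Complex.sub_im, Complex.re_ofReal_mul,
      Complex.im_ofReal_mul, hone.2] at hp
    exact ⟨by linarith [hp.2], by linarith [hp.1]⟩
  have hre : ∀ z : H →L[ℂ] H, (φ z).re ≤ ‖z‖ * (φ 1).re := by
    intro z
    have hz : φ z = φ (realPart z) + Complex.I * φ (imaginaryPart z) := by
      conv_lhs => rw [← realPart_add_I_smul_imaginaryPart z]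
      rw [map_add, map_smul, smul_eq_mul]
    have him := (hsa _ (imaginaryPart z).2).1
    have hr := (hsa _ (realPart z).2).2
    have hn : ‖(realPart z : H →L[ℂ] H)‖ ≤ ‖z‖ := realPart.norm_le z
    rw [hz, Complex.add_re, Complex.I_mul_re, him, neg_zero, add_zero]
    exact hr.trans (mul_le_mul_of_nonneg_right hn hone.1)
  rw [← h1]
  refine ContinuousLinearMap.opNorm_le_bound _ hone.1 fun x => ?_
  obtain ⟨c, hc, hcx⟩ : ∃ c : ℂ, ‖c‖ = 1 ∧ c * φ x = ‖φ x‖ := by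
    obtain ⟨c, hc, h⟩ := RCLike.exists_norm_eq_mul_self (φ x)
    exact ⟨c, hc, h.symm⟩
  have := hre (c • x)
  rw [map_smul, smul_eq_mul, hcx, norm_smul, hc, one_mul, Complex.ofReal_re] at this
  linarith

end Functionals

section Minkowski

variable {H : Type*} [NormedAddCommGroup H] [InnerProductSpace ℂ H]

theorem qK_le_mul {A B : Set ((H →L[ℂ] H) →L[ℂ] ℂ)} {φ : (H →L[ℂ] H) →L[ℂ] ℂ} {c : ℝ}
    (hc : 0 < c) (h : ∀ r : ℝ, 0 ≤ r → φ ∈ r • A → φ ∈ (c * r) • B) :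
    qK B φ ≤ ENNReal.ofReal c * qK A φ := by
  have hc0 : ENNReal.ofReal c ≠ 0 := by simpa using hc
  rw [mul_comm, ← ENNReal.div_le_iff_le_mul (Or.inl hc0) (Or.inl ENNReal.ofReal_ne_top)]
  refine le_sInf ?_
  rintro _ ⟨r, hr, rfl, hφ⟩
  rw [ENNReal.div_le_iff_le_mul (Or.inl hc0) (Or.inl ENNReal.ofReal_ne_top), mul_comm,
    ← ENNReal.ofReal_mul hc.le]
  exact sInf_le ⟨c * r, by positivity, rfl, h r hr hφ⟩

theorem norm_le_qK {A : Set ((H →L[ℂ] H) →L[ℂ] ℂ)} {φ : (H →L[ℂ] H) →L[ℂ] ℂ}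
    (hA : ∀ ψ ∈ A, ‖ψ‖ ≤ 1) : ENNReal.ofReal ‖φ‖ ≤ qK A φ := by
  refine le_sInf ?_
  rintro _ ⟨r, hr, rfl, ψ, hψ, rfl⟩
  refine ENNReal.ofReal_le_ofReal ?_
  change ‖r • ψ‖ ≤ r
  rw [norm_smul, Real.norm_of_nonneg hr]
  exact mul_le_of_le_one_right hr (hA ψ hψ)

theorem qK_le_one_of_mem {A : Set ((H →L[ℂ] H) →L[ℂ] ℂ)} {φ : (H →L[ℂ] H) →L[ℂ] ℂ}
    (h : φ ∈ A) : qK A φ ≤ 1 :=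
  sInf_le ⟨1, zero_le_one, by simp, by simpa using h⟩

/-- On a closed set of functionals the infimum defining `qK`, when equal to one, is attained. -/
theorem mem_of_qK_eq_one {A : Set ((H →L[ℂ] H) →L[ℂ] ℂ)} (hA : IsClosed A)
    {φ : (H →L[ℂ] H) →L[ℂ] ℂ} (h : qK A φ = 1) : φ ∈ A := by
  have hex : ∀ n : ℕ, ∃ r : ℝ, 1 ≤ r ∧ r < 1 + 1 / ((n : ℝ) + 1) ∧ φ ∈ r • A := by
    intro n
    have hn : (0 : ℝ) < 1 / ((n : ℝ) + 1) := by positivity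
    have hlt : qK A φ < ENNReal.ofReal (1 + 1 / ((n : ℝ) + 1)) := by
      rw [h, ← ENNReal.ofReal_one]
      exact (ENNReal.ofReal_lt_ofReal_iff (by linarith)).2 (by linarith)
    obtain ⟨_, ⟨r, hr, rfl, hφ⟩, hr'⟩ := sInf_lt_iff.1 hlt
    refine ⟨r, ?_, ((ENNReal.ofReal_lt_ofReal_iff (by linarith)).1 hr'), hφ⟩
    have : qK A φ ≤ ENNReal.ofReal r := sInf_le ⟨r, hr, rfl, hφ⟩
    rwa [h, ENNReal.one_le_ofReal] at this
  choose r hr1 hr2 hφ using hex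
  have hlim : Filter.Tendsto r Filter.atTop (nhds 1) := by
    refine tendsto_of_tendsto_of_tendsto_of_le_of_le tendsto_const_nhds ?_ hr1
      fun n => (hr2 n).le
    simpa using tendsto_one_div_add_atTop_nhds_zero_nat.const_add (1 : ℝ)
  have hlim' : Filter.Tendsto (fun n => (r n)⁻¹ • φ) Filter.atTop (nhds φ) := by
    simpa using (hlim.inv₀ one_ne_zero).smul_const φ
  refine hA.mem_of_tendsto hlim' (Filter.Eventually.of_forall fun n => ?_)
  exact (Set.mem_smul_set_iff_inv_smul_mem₀ (by linarith [hr1 n]) _ _).1 (hφ n)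

end Minkowski

section Separable

variable {H : Type*} [NormedAddCommGroup H] [InnerProductSpace ℂ H]

/-- A convex combination of functionals `ω_{ξ,η}` with unit vectors `ξ, η ∈ V` is close to one of
functionals `ω_ξ` when its value at the identity is close to one. -/
theorem exists_mem_convexHull_norm_sub_sq_le {V : Set H} (hV : ∀ ξ ∈ V, ‖ξ‖ = 1)
    {ψ : (H →L[ℂ] H) →L[ℂ] ℂ}
    (hψ : ψ ∈ convexHull ℝ {φ : (H →L[ℂ] H) →L[ℂ] ℂ |
      ∃ ξ ∈ V, ∃ η ∈ V, φ = omegaFunctional ξ η}) :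
    ∃ s ∈ convexHull ℝ {φ : (H →L[ℂ] H) →L[ℂ] ℂ | ∃ ξ ∈ V, φ = omegaFunctional ξ ξ},
      ‖ψ - s‖ ^ 2 ≤ 2 - 2 * (ψ 1).re := by
  set D := {φ : (H →L[ℂ] H) →L[ℂ] ℂ | ∃ ξ ∈ V, φ = omegaFunctional ξ ξ}
  refine convexHull_min (t := {ψ : (H →L[ℂ] H) →L[ℂ] ℂ |
    ∃ s ∈ convexHull ℝ D, ‖ψ - s‖ ^ 2 ≤ 2 - 2 * (ψ 1).re}) ?_ ?_ hψ
  · rintro _ ⟨ξ, hξ, η, hη, rfl⟩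
    refine ⟨omegaFunctional ξ ξ, subset_convexHull ℝ D ⟨ξ, hξ, rfl⟩, ?_⟩
    rw [← omegaFunctional_sub_right]
    have h1 := norm_omegaFunctional_le ξ (η - ξ)
    rw [hV ξ hξ, one_mul] at h1
    refine (pow_le_pow_left₀ (norm_nonneg _) h1 2).trans ?_
    rw [@norm_sub_sq ℂ, hV ξ hξ, hV η hη]
    simp only [omegaFunctional_apply, one_apply_eq_self, RCLike.re_to_complex]
    linarith
  · rintro ψ₁ ⟨s₁, hs₁, h₁⟩ ψ₂ ⟨s₂, hs₂, h₂⟩ a b ha hb hab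
    refine ⟨a • s₁ + b • s₂, convex_convexHull ℝ D hs₁ hs₂ ha hb hab, ?_⟩
    have hn : ‖a • ψ₁ + b • ψ₂ - (a • s₁ + b • s₂)‖ ≤ a * ‖ψ₁ - s₁‖ + b * ‖ψ₂ - s₂‖ := by
      have : a • ψ₁ + b • ψ₂ - (a • s₁ + b • s₂) = a • (ψ₁ - s₁) + b • (ψ₂ - s₂) := by
        module
      rw [this]
      refine (norm_add_le _ _).trans_eq ?_
      rw [norm_smul, norm_smul, Real.norm_of_nonneg ha, Real.norm_of_nonneg hb]
    have hconv := (convexOn_pow (𝕜 := ℝ) 2).2 (norm_nonneg (ψ₁ - s₁)) (norm_nonneg (ψ₂ - s₂))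
      ha hb hab
    simp only [smul_eq_mul] at hconv
    have hr : ((a • ψ₁ + b • ψ₂) 1).re = a * (ψ₁ 1).re + b * (ψ₂ 1).re := by
      simp
    have e : (2 : ℝ) - 2 * (a * (ψ₁ 1).re + b * (ψ₂ 1).re) =
        a * (2 - 2 * (ψ₁ 1).re) + b * (2 - 2 * (ψ₂ 1).re) := by
      linear_combination (-2 : ℝ) * hab
    rw [hr, e]
    calc _ ≤ _ := pow_le_pow_left₀ (norm_nonneg _) hn 2
      _ ≤ _ := hconv
      _ ≤ _ := by gcongr

/-- A functional in the closed convex hull of the `ω_{ξ,η}`, with unit vectors `ξ, η ∈ V`, whose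
value at the identity has real part at least one lies in the closed convex hull of the `ω_ξ`. -/
theorem mem_closure_convexHull_of_one_le_re {V : Set H} (hV : ∀ ξ ∈ V, ‖ξ‖ = 1)
    {φ : (H →L[ℂ] H) →L[ℂ] ℂ} (h1 : 1 ≤ (φ 1).re)
    (hφ : φ ∈ closure (convexHull ℝ {φ : (H →L[ℂ] H) →L[ℂ] ℂ |
      ∃ ξ ∈ V, ∃ η ∈ V, φ = omegaFunctional ξ η})) :
    φ ∈ closure (convexHull ℝ
      {φ : (H →L[ℂ] H) →L[ℂ] ℂ | ∃ ξ ∈ V, φ = omegaFunctional ξ ξ}) := by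
  obtain ⟨ψ, hψ, hlim⟩ := mem_closure_iff_seq_limit.1 hφ
  choose s hs hle using fun n => exists_mem_convexHull_norm_sub_sq_le hV (hψ n)
  have hval : Filter.Tendsto (fun n => 2 - 2 * (ψ n 1).re) Filter.atTop
      (nhds (2 - 2 * (φ 1).re)) := by
    have hc : Continuous fun f : (H →L[ℂ] H) →L[ℂ] ℂ => 2 - 2 * (f 1).re := by fun_prop
    exact (hc.tendsto φ).comp hlim
  have hsq : Filter.Tendsto (fun n => ‖ψ n - s n‖ ^ 2) Filter.atTop (nhds 0) := by
    have hz : 2 - 2 * (φ 1).re = 0 :=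
      le_antisymm (by linarith)
        (ge_of_tendsto' hval fun n => (sq_nonneg _).trans (hle n))
    rw [hz] at hval
    exact squeeze_zero (fun n => sq_nonneg _) hle hval
  have hsub : Filter.Tendsto (fun n => ψ n - s n) Filter.atTop (nhds 0) := by
    rw [tendsto_zero_iff_norm_tendsto_zero]
    simpa [Real.sqrt_sq] using hsq.sqrt
  refine mem_closure_of_tendsto (f := s) (b := Filter.atTop) ?_ (Filter.Eventually.of_forall hs)
  simpa using hlim.sub hsub

end Separable

theorem map_mem_closure_convexHull {E : Type*} [SeminormedAddCommGroup E] [NormedSpace ℝ E]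
    (G : E →L[ℝ] E) {A B : Set E} (h : ∀ a ∈ A, G a ∈ closure (convexHull ℝ B)) {a : E}
    (ha : a ∈ closure (convexHull ℝ A)) : G a ∈ closure (convexHull ℝ B) := by
  have hconv : Convex ℝ (G ⁻¹' closure (convexHull ℝ B)) :=
    (convex_convexHull ℝ B).closure.linear_preimage G.toLinearMap
  exact closure_minimal (convexHull_min h hconv) (isClosed_closure.preimage G.continuous) ha

namespace HilbertTensorPower

open Finset

section Comparison

variable {k : ℕ} {H T : Type*} [NormedAddCommGroup H] [InnerProductSpace ℂ H]
  [NormedAddCommGroup T] [InnerProductSpace ℂ T] (P : HilbertTensorPower k H T)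

theorem inv_factorial_smul_omegaFunctional_mem {ξ η : T} (hξ : ξ ∈ P.wedgeVecs)
    (hη : η ∈ P.wedgeVecs) :
    (k.factorial : ℝ)⁻¹ • omegaFunctional ξ η ∈ convexHull ℝ
      {φ : (T →L[ℂ] T) →L[ℂ] ℂ | ∃ ξ ∈ P.prodVecs, ∃ η ∈ P.prodVecs,
        φ = omegaFunctional ξ η} := by
  obtain ⟨e, he, rfl⟩ := P.exists_unit_of_mem_wedgeVecs hξ
  obtain ⟨f, hf, rfl⟩ := P.exists_unit_of_mem_wedgeVecs hη
  have hk : (k.factorial : ℝ) ≠ 0 := Nat.cast_ne_zero.2 k.factorial_ne_zero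
  have hs : ((Real.sqrt k.factorial : ℂ) * (k.factorial : ℂ)⁻¹) *
      starRingEnd ℂ ((Real.sqrt k.factorial : ℂ) * (k.factorial : ℂ)⁻¹) =
      (((k.factorial : ℝ)⁻¹ : ℝ) : ℂ) := by
    have hk' : (k.factorial : ℂ) ≠ 0 := Nat.cast_ne_zero.2 k.factorial_ne_zero
    rw [map_mul, Complex.conj_ofReal, map_inv₀, Complex.conj_natCast, mul_mul_mul_comm,
      sqrt_factorial_mul_self]
    push_cast
    field_simp
  have key : (k.factorial : ℝ)⁻¹ • omegaFunctional (P.wedge e) (P.wedge f) =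
      ∑ p ∈ (univ ×ˢ univ : Finset (Equiv.Perm (Fin k) × Equiv.Perm (Fin k))),
        ((k.factorial : ℝ)⁻¹ * (k.factorial : ℝ)⁻¹) •
        omegaFunctional (((Equiv.Perm.sign p.1 : ℤ) : ℂ) • P.tprod fun i => e (p.1 i))
          (((Equiv.Perm.sign p.2 : ℤ) : ℂ) • P.tprod fun i => f (p.2 i)) := by
    rw [← smul_sum, sum_product, wedge_eq_sum, wedge_eq_sum, omegaFunctional_smul_left,
      omegaFunctional_smul_right, smul_smul, hs, Complex.coe_smul, smul_smul, omegaFunctional_sum]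
  rw [key]
  refine (convex_convexHull ℝ _).sum_mem (fun _ _ => by positivity) ?_ fun p _ => ?_
  · simp only [univ_product_univ, sum_const, card_univ, Fintype.card_prod, Fintype.card_perm,
      Fintype.card_fin, nsmul_eq_mul]
    push_cast
    field_simp
  · exact subset_convexHull ℝ _ ⟨_, P.sign_smul_tprod_mem_prodVecs he p.1, _,
      P.sign_smul_tprod_mem_prodVecs hf p.2, rfl⟩

theorem smul_mem_wedgeVecs [NeZero k] {c : ℂ} {η : Fin k → H} (h : ‖c • P.wedge η‖ = 1) :
    c • P.wedge η ∈ P.wedgeVecs :=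
  ⟨_, P.exists_smul_wedge c η, h⟩

theorem zero_mem_convexHull_wedge [NeZero k] {ζ : T} (hζ : ζ ∈ P.wedgeVecs) :
    (0 : (T →L[ℂ] T) →L[ℂ] ℂ) ∈ convexHull ℝ
      {φ : (T →L[ℂ] T) →L[ℂ] ℂ | ∃ ξ ∈ P.wedgeVecs, ∃ η ∈ P.wedgeVecs,
        φ = omegaFunctional ξ η} := by
  have hneg : (-1 : ℂ) • ζ ∈ P.wedgeVecs := by
    obtain ⟨η, rfl, h1⟩ := hζ
    exact P.smul_mem_wedgeVecs (by simp [h1])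
  have h := convex_convexHull ℝ _
    (subset_convexHull ℝ {φ : (T →L[ℂ] T) →L[ℂ] ℂ | ∃ ξ ∈ P.wedgeVecs, ∃ η ∈ P.wedgeVecs,
        φ = omegaFunctional ξ η} ⟨ζ, hζ, ζ, hζ, rfl⟩)
    (subset_convexHull ℝ _ ⟨_, hneg, ζ, hζ, rfl⟩)
    (a := 1 / 2) (b := 1 / 2) (by norm_num) (by norm_num) (by norm_num)
  rw [omegaFunctional_smul_left, neg_one_smul, smul_neg, add_neg_cancel] at h
  exact h

theorem exists_mem_wedgeVecs (hP : P.Pminus ≠ 0) : P.wedgeVecs.Nonempty := by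
  obtain ⟨η, hη⟩ : ∃ η, P.wedge η ≠ 0 := by
    by_contra! hc
    refine hP (ContinuousLinearMap.ext_on
      ((Submodule.dense_iff_topologicalClosure_eq_top).2 P.span_dense) ?_)
    rintro _ ⟨η, rfl⟩
    simp [Pminus_tprod, hc]
  obtain ⟨e, c, he, -, -⟩ := P.exists_orthonormal_wedge hη
  exact ⟨_, e, rfl, P.norm_wedge_of_orthonormal he⟩

theorem omegaFunctional_wedge_mem (hP : P.Pminus ≠ 0) {ξ η : Fin k → H} (hξ : ∀ i, ‖ξ i‖ = 1)
    (hη : ∀ i, ‖η i‖ = 1) :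
    omegaFunctional (P.wedge ξ) (P.wedge η) ∈ convexHull ℝ
      {φ : (T →L[ℂ] T) →L[ℂ] ℂ | ∃ ξ ∈ P.wedgeVecs, ∃ η ∈ P.wedgeVecs,
        φ = omegaFunctional ξ η} := by
  rcases isEmpty_or_nonempty (Fin k) with hk | hk
  · refine subset_convexHull ℝ _ ⟨_, ⟨ξ, rfl, ?_⟩, _, ⟨η, rfl, ?_⟩, rfl⟩ <;>
      rw [wedge_of_isEmpty, norm_tprod] <;> simp
  have : NeZero k := ⟨fun h => by subst h; exact Fin.elim0 hk.some⟩
  obtain ⟨ζ, hζ⟩ := P.exists_mem_wedgeVecs hP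
  have hzero := P.zero_mem_convexHull_wedge hζ
  by_cases hξ0 : P.wedge ξ = 0
  · have : omegaFunctional (P.wedge ξ) (P.wedge η) = 0 := by
      ext x; simp [omegaFunctional_apply, hξ0]
    rwa [this]
  by_cases hη0 : P.wedge η = 0
  · have : omegaFunctional (P.wedge ξ) (P.wedge η) = 0 := by
      ext x; simp [omegaFunctional_apply, hη0]
    rwa [this]
  have hle : ∀ {ζ : Fin k → H}, (∀ i, ‖ζ i‖ = 1) → ‖P.wedge ζ‖ ≤ 1 := by
    intro ζ hζ
    simpa [hζ] using P.norm_wedge_le ζ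
  have hnormalize : ∀ {ζ : Fin k → H}, P.wedge ζ ≠ 0 →
      ((‖P.wedge ζ‖⁻¹ : ℝ) : ℂ) • P.wedge ζ ∈ P.wedgeVecs := by
    intro ζ hζ
    refine P.smul_mem_wedgeVecs ?_
    rw [norm_smul, Complex.norm_real, norm_inv, norm_norm, inv_mul_cancel₀ (norm_ne_zero_iff.2 hζ)]
  have hmem := subset_convexHull ℝ {φ : (T →L[ℂ] T) →L[ℂ] ℂ | ∃ ξ ∈ P.wedgeVecs,
    ∃ η ∈ P.wedgeVecs, φ = omegaFunctional ξ η} ⟨_, hnormalize hξ0, _, hnormalize hη0, rfl⟩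
  have h := (convex_convexHull ℝ _).smul_mem_of_zero_mem hzero hmem
    (t := ‖P.wedge ξ‖ * ‖P.wedge η‖)
    ⟨by positivity, mul_le_one₀ (hle hξ) (norm_nonneg _) (hle hη)⟩
  have h1 : ‖P.wedge ξ‖ * ‖P.wedge η‖ * ‖P.wedge ξ‖⁻¹ * ‖P.wedge η‖⁻¹ = 1 := by
    have := norm_ne_zero_iff.2 hξ0
    have := norm_ne_zero_iff.2 hη0
    field_simp
  rw [omegaFunctional_smul_left, omegaFunctional_smul_right, Complex.conj_ofReal,
    Complex.coe_smul, Complex.coe_smul, smul_smul, smul_smul, h1, one_smul] at h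
  exact h

/-- The compression `ψ ↦ ψ(P₋ · P₋)` of functionals. -/
def compression : ((T →L[ℂ] T) →L[ℂ] ℂ) →L[ℂ] ((T →L[ℂ] T) →L[ℂ] ℂ) :=
  (ContinuousLinearMap.compL ℂ (T →L[ℂ] T) (T →L[ℂ] T) ℂ).flip
    ((ContinuousLinearMap.compL ℂ T T T P.Pminus).comp
      ((ContinuousLinearMap.compL ℂ T T T).flip P.Pminus))

theorem compression_apply (ψ : (T →L[ℂ] T) →L[ℂ] ℂ) (x : T →L[ℂ] T) :
    P.compression ψ x = ψ (P.Pminus ∘L x ∘L P.Pminus) := rfl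

theorem compression_omegaFunctional (ξ η : T) :
    P.compression (omegaFunctional ξ η) = omegaFunctional (P.Pminus ξ) (P.Pminus η) := by
  ext x
  exact (P.inner_Pminus_left _ _).symm

theorem factorial_smul_compression_tprod (ξ η : Fin k → H) :
    (k.factorial : ℝ) • P.compression (omegaFunctional (P.tprod ξ) (P.tprod η)) =
      omegaFunctional (P.wedge ξ) (P.wedge η) := by
  rw [compression_omegaFunctional, wedge, wedge, omegaFunctional_smul_left,
    omegaFunctional_smul_right, Complex.conj_ofReal, smul_smul, sqrt_factorial_mul_self,
    ← Complex.coe_smul, Complex.ofReal_natCast]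

theorem norm_eq_one_of_mem_wedgeVecs {ζ : T} (hζ : ζ ∈ P.wedgeVecs) : ‖ζ‖ = 1 := by
  obtain ⟨_, _, h⟩ := hζ
  exact h

theorem qK_prod_le_factorial_mul (φ : (T →L[ℂ] T) →L[ℂ] ℂ) :
    qK (closure (convexHull ℝ {φ : (T →L[ℂ] T) →L[ℂ] ℂ | ∃ ξ ∈ P.prodVecs, ∃ η ∈ P.prodVecs,
        φ = omegaFunctional ξ η})) φ ≤
      ENNReal.ofReal k.factorial *
    qK (closure (convexHull ℝ {φ : (T →L[ℂ] T) →L[ℂ] ℂ | ∃ ξ ∈ P.wedgeVecs, ∃ η ∈ P.wedgeVecs,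
        φ = omegaFunctional ξ η})) φ := by
  have hk : (k.factorial : ℝ) ≠ 0 := Nat.cast_ne_zero.2 k.factorial_ne_zero
  refine qK_le_mul (Nat.cast_pos.2 k.factorial_pos) ?_
  rintro r - ⟨ψ, hψ, rfl⟩
  refine ⟨(k.factorial : ℝ)⁻¹ • ψ, ?_, ?_⟩
  · refine map_mem_closure_convexHull
      ((k.factorial : ℝ)⁻¹ • ContinuousLinearMap.id ℝ ((T →L[ℂ] T) →L[ℂ] ℂ)) ?_ hψ
    rintro _ ⟨ξ, hξ, η, hη, rfl⟩
    exact subset_closure (P.inv_factorial_smul_omegaFunctional_mem hξ hη)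
  · change (k.factorial * r) • (k.factorial : ℝ)⁻¹ • ψ = r • ψ
    rw [smul_smul, mul_right_comm, mul_inv_cancel₀ hk, one_mul]

theorem qK_wedge_le_inv_factorial_mul {φ : (T →L[ℂ] T) →L[ℂ] ℂ} (h0 : φ ≠ 0)
    (hφP : P.compression φ = φ) :
    qK (closure (convexHull ℝ {φ : (T →L[ℂ] T) →L[ℂ] ℂ | ∃ ξ ∈ P.wedgeVecs, ∃ η ∈ P.wedgeVecs,
        φ = omegaFunctional ξ η})) φ ≤
      ENNReal.ofReal (k.factorial : ℝ)⁻¹ *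
    qK (closure (convexHull ℝ {φ : (T →L[ℂ] T) →L[ℂ] ℂ | ∃ ξ ∈ P.prodVecs, ∃ η ∈ P.prodVecs,
        φ = omegaFunctional ξ η})) φ := by
  have hk : (k.factorial : ℝ) ≠ 0 := Nat.cast_ne_zero.2 k.factorial_ne_zero
  have hP : P.Pminus ≠ 0 := by
    intro hP
    refine h0 ?_
    rw [← hφP]
    ext x
    simp [compression_apply, hP]
  refine qK_le_mul (inv_pos.2 (Nat.cast_pos.2 k.factorial_pos)) ?_
  rintro r - ⟨ψ, hψ, hr⟩
  change r • ψ = φ at hr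
  refine ⟨(k.factorial : ℝ) • P.compression ψ, ?_, ?_⟩
  · refine map_mem_closure_convexHull
      ((k.factorial : ℝ) • P.compression.restrictScalars ℝ) ?_ hψ
    rintro _ ⟨_, ⟨ξ, hξ, rfl⟩, _, ⟨η, hη, rfl⟩, rfl⟩
    refine subset_closure ?_
    have := P.omegaFunctional_wedge_mem hP hξ hη
    rwa [← factorial_smul_compression_tprod] at this
  · change ((k.factorial : ℝ)⁻¹ * r) • (k.factorial : ℝ) • P.compression ψ = φ
    rw [smul_smul, mul_right_comm, inv_mul_cancel₀ hk, one_mul]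
    conv_rhs => rw [← hφP, ← hr]
    exact (map_smul (P.compression.restrictScalars ℝ) r ψ).symm

theorem norm_le_one_of_mem_closure_convexHull_wedge {ψ : (T →L[ℂ] T) →L[ℂ] ℂ}
    (hψ : ψ ∈ closure (convexHull ℝ {φ : (T →L[ℂ] T) →L[ℂ] ℂ | ∃ ξ ∈ P.wedgeVecs,
      ∃ η ∈ P.wedgeVecs, φ = omegaFunctional ξ η})) : ‖ψ‖ ≤ 1 := by
  rw [← mem_closedBall_zero_iff]
  refine closure_minimal (convexHull_min ?_ (convex_closedBall _ _)) Metric.isClosed_closedBall hψ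
  rintro _ ⟨ξ, hξ, η, hη, rfl⟩
  rw [mem_closedBall_zero_iff]
  refine (norm_omegaFunctional_le ξ η).trans ?_
  rw [P.norm_eq_one_of_mem_wedgeVecs hξ, P.norm_eq_one_of_mem_wedgeVecs hη, one_mul]

end Comparison

end HilbertTensorPower

end NormedDual

/-- Let `φ₋` be a normal state on `B(H^{∧k})`, viewed as a normal state on
`B(H^{⊗k})` via the identification `B(H^{∧k}) ≅ P₋B(H^{⊗k})P₋` (i.e. `φ₋(x) = φ₋(P₋xP₋)`).
Then `q_{K^{∧k}}(φ₋) = (1/k!)·q_{K^{⊗k}}(φ₋)`; in particular `q_{K^{⊗k}}(φ₋) ≥ k!` with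
equality iff `φ₋` is fermionic separable, i.e. lies in the norm-closed convex hull of
`{ω_ξ : ξ ∈ V^{∧k}}`. -/
theorem stmt15 {H T : Type*} [NormedAddCommGroup H] [InnerProductSpace ℂ H] [CompleteSpace H]
    [NormedAddCommGroup T] [InnerProductSpace ℂ T] [CompleteSpace T]
    (k : ℕ) (P : HilbertTensorPower k H T)
    (Kt Kw : Set ((T →L[ℂ] T) →L[ℂ] ℂ))
    (hKt : Kt = closure (convexHull ℝ
      {φ : (T →L[ℂ] T) →L[ℂ] ℂ | ∃ ξ ∈ P.prodVecs, ∃ η ∈ P.prodVecs,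
        φ = omegaFunctional ξ η}))
    (hKw : Kw = closure (convexHull ℝ
      {φ : (T →L[ℂ] T) →L[ℂ] ℂ | ∃ ξ ∈ P.wedgeVecs, ∃ η ∈ P.wedgeVecs,
        φ = omegaFunctional ξ η}))
    (φ : (T →L[ℂ] T) →L[ℂ] ℂ) (hφ : IsNormalState φ)
    (hφP : ∀ x : T →L[ℂ] T, φ x = φ (P.Pminus ∘L x ∘L P.Pminus)) :
    qK Kw φ = (k.factorial : ℝ≥0∞)⁻¹ * qK Kt φ ∧
    (k.factorial : ℝ≥0∞) ≤ qK Kt φ ∧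
    (qK Kt φ = (k.factorial : ℝ≥0∞) ↔ φ ∈ closure (convexHull ℝ
      {ψ : (T →L[ℂ] T) →L[ℂ] ℂ | ∃ ξ ∈ P.wedgeVecs, ψ = omegaFunctional ξ ξ})) := by
  subst hKt hKw
  obtain ⟨-, h1, hpos⟩ := hφ
  have hk0 : (k.factorial : ℝ≥0∞) ≠ 0 := Nat.cast_ne_zero.2 k.factorial_ne_zero
  have hktop : (k.factorial : ℝ≥0∞) ≠ ⊤ := ENNReal.natCast_ne_top _
  have h0 : φ ≠ 0 := by
    rintro rfl
    simp at h1
  have hle := P.qK_prod_le_factorial_mul φ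
  have hge := P.qK_wedge_le_inv_factorial_mul h0 (ContinuousLinearMap.ext fun x => (hφP x).symm)
  rw [ENNReal.ofReal_natCast] at hle
  rw [ENNReal.ofReal_inv_of_pos (Nat.cast_pos.2 k.factorial_pos), ENNReal.ofReal_natCast] at hge
  set qt := qK (closure (convexHull ℝ {φ : (T →L[ℂ] T) →L[ℂ] ℂ | ∃ ξ ∈ P.prodVecs,
    ∃ η ∈ P.prodVecs, φ = omegaFunctional ξ η})) φ
  have heq : qK (closure (convexHull ℝ {φ : (T →L[ℂ] T) →L[ℂ] ℂ | ∃ ξ ∈ P.wedgeVecs,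
      ∃ η ∈ P.wedgeVecs, φ = omegaFunctional ξ η})) φ = (k.factorial : ℝ≥0∞)⁻¹ * qt := by
    refine le_antisymm hge ?_
    rw [mul_comm, ← div_eq_mul_inv]
    exact ENNReal.div_le_of_le_mul' hle
  have hone : 1 ≤ qK (closure (convexHull ℝ {φ : (T →L[ℂ] T) →L[ℂ] ℂ | ∃ ξ ∈ P.wedgeVecs,
      ∃ η ∈ P.wedgeVecs, φ = omegaFunctional ξ η})) φ := by
    have := norm_le_qK (φ := φ) fun ψ hψ => P.norm_le_one_of_mem_closure_convexHull_wedge hψ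
    rwa [h1, ENNReal.ofReal_one] at this
  have hfac : (k.factorial : ℝ≥0∞) ≤ qt := by
    rw [heq, mul_comm, ← div_eq_mul_inv, ENNReal.le_div_iff_mul_le (Or.inl hk0) (Or.inl hktop),
      one_mul] at hone
    exact hone
  refine ⟨heq, hfac, fun h => ?_, fun h => ?_⟩
  · rw [h, ENNReal.inv_mul_cancel hk0 hktop] at heq
    exact mem_closure_convexHull_of_one_le_re (fun _ => P.norm_eq_one_of_mem_wedgeVecs)
      (one_le_re_apply_one h1 hpos) (mem_of_qK_eq_one isClosed_closure heq)
  · refine le_antisymm ?_ hfac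
    have hmem : φ ∈ closure (convexHull ℝ {φ : (T →L[ℂ] T) →L[ℂ] ℂ | ∃ ξ ∈ P.wedgeVecs,
        ∃ η ∈ P.wedgeVecs, φ = omegaFunctional ξ η}) := by
      refine closure_mono (convexHull_mono ?_) h
      rintro _ ⟨ξ, hξ, rfl⟩
      exact ⟨ξ, hξ, ξ, hξ, rfl⟩
    calc qt ≤ _ := hle
      _ ≤ k.factorial * 1 := by gcongr; exact qK_le_one_of_mem hmem
      _ = k.factorial := mul_one _
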